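/- arXiv:1008.0988 — 6 statements merged into one kernel-verified Lean document; each statement's English description precedes it below -/
import Mathlib

section
/- Let (Ũ, G, π) be a uniformizing system of dimension n for an open set U ⊆ X, let x̃ ∈ Ũ and let Ã ⊆ Ũ be an open neighborhood of x̃. Then there exist a uniformizing system (Ũ', G', π') of dimension n for an open subset of X and an embedding λ of (Ũ', G', π') into (Ũ, G, π) such that: Ũ' is an open connected neighborhood of x̃ completely contained in Ã; λ is the inclusion map Ũ' ↪ Ũ; G' is the set of the restrictions to Ũ' of the elements of the isotropy subgroup G_{x̃} (in particular Ũ' is invariant under G_{x̃}); and, up to a biholomorphic change of coordinates, all elements of G' act linearly on Ũ'. -/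
open Set

noncomputable section

/-- `ℂⁿ`. -/
abbrev CC (n : ℕ) : Type := EuclideanSpace ℂ (Fin n)

/-- A (reduced complex) uniformizing system of dimension `n` for the open set
`U := p '' Ut` of `X`: `Ut ⊆ ℂⁿ` is a nonempty connected open set, `G` is a finite
group of holomorphic automorphisms of `Ut` (encoded as total maps that agree with the
identity outside `Ut`, so that `G` is honestly a set of maps closed under composition
and inversion), and `p` (the map `π`) is continuous, surjective and `G`-invariant on
`Ut`, inducing a homeomorphism `Ut/G ≃ U` (encoded by: the fibres of `p` on `Ut` are
exactly the `G`-orbits and `p` is an open map on `Ut`). -/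
structure UniformizingSystem (n : ℕ) (X : Type*) [TopologicalSpace X] where
  Ut : Set (CC n)
  isOpen_Ut : IsOpen Ut
  isConnected_Ut : IsConnected Ut
  G : Set (CC n → CC n)
  finite_G : G.Finite
  id_mem_G : (id : CC n → CC n) ∈ G
  comp_mem_G : ∀ g ∈ G, ∀ h ∈ G, (g ∘ h) ∈ G
  inv_mem_G : ∀ g ∈ G, ∃ g' ∈ G, (∀ x, g' (g x) = x) ∧ (∀ x, g (g' x) = x)
  mapsTo_G : ∀ g ∈ G, Set.MapsTo g Ut Ut
  eqOn_id_G : ∀ g ∈ G, Set.EqOn g id Utᶜ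
  analytic_G : ∀ g ∈ G, AnalyticOnNhd ℂ g Ut
  p : CC n → X
  continuousOn_p : ContinuousOn p Ut
  isOpen_image_p : IsOpen (p '' Ut)
  invariant_p : ∀ g ∈ G, ∀ x ∈ Ut, p (g x) = p x
  exists_g_of_p_eq : ∀ x ∈ Ut, ∀ y ∈ Ut, p x = p y → ∃ g ∈ G, g x = y
  isOpenMap_p : ∀ V : Set (CC n), V ⊆ Ut → IsOpen V → IsOpen (p '' V)

/-- The underlying open subset of `X` uniformized by the system. -/
def UniformizingSystem.U {n : ℕ} {X : Type*} [TopologicalSpace X]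
    (𝒰 : UniformizingSystem n X) : Set X := 𝒰.p '' 𝒰.Ut

/-- An embedding `l : (Ũ,G,π) → (Ṽ,H,φ)` of uniformizing systems: a holomorphic
embedding (injective, biholomorphism onto its open image) with `φ ∘ l = π` on `Ũ`. -/
structure IsUSEmbedding {n : ℕ} {X : Type*} [TopologicalSpace X]
    (𝒰 𝒱 : UniformizingSystem n X) (l : CC n → CC n) : Prop where
  mapsTo : Set.MapsTo l 𝒰.Ut 𝒱.Ut
  injOn : Set.InjOn l 𝒰.Ut
  analyticOn : AnalyticOnNhd ℂ l 𝒰.Ut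
  isOpen_image : IsOpen (l '' 𝒰.Ut)
  exists_analytic_inv : ∃ m : CC n → CC n,
    AnalyticOnNhd ℂ m (l '' 𝒰.Ut) ∧ ∀ x ∈ 𝒰.Ut, m (l x) = x
  comp_p : ∀ x ∈ 𝒰.Ut, 𝒱.p (l x) = 𝒰.p x

/-- Averaging over a finite group of maps fixing `x` and analytic at `x` yields a map that is a
local biholomorphism at `x` and conjugates the group action to a linear one. -/
theorem exists_linearization {E : Type*} [NormedAddCommGroup E] [NormedSpace ℂ E]
    (H : Subgroup (Equiv.Perm E)) [Finite H] {x : E} (hfix : ∀ h ∈ H, h x = x)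
    (han : ∀ h ∈ H, AnalyticAt ℂ h x) :
    ∃ φ : E → E, AnalyticAt ℂ φ x ∧
      (∃ f' : E ≃L[ℂ] E, HasFDerivAt φ (f' : E →L[ℂ] E) x) ∧
      ∀ h ∈ H, ∃ L : E →L[ℂ] E, ∀ y, φ (h y) = L (φ y) := by
  have := Fintype.ofFinite H
  have hd : ∀ h ∈ H, HasFDerivAt (h : E → E) (fderiv ℂ h x) x := fun h hh =>
    (han h hh).differentiableAt.hasFDerivAt
  have hmul : ∀ g ∈ H, ∀ h ∈ H,
      fderiv ℂ (g * h : Equiv.Perm E) x = (fderiv ℂ g x).comp (fderiv ℂ h x) := by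
    intro g hg h hh
    have hg' : HasFDerivAt (g : E → E) (fderiv ℂ g x) (h x) := by
      rw [hfix h hh]; exact hd g hg
    exact (hg'.comp x (hd h hh)).fderiv
  have hinv : ∀ g ∈ H, (fderiv ℂ g x).comp (fderiv ℂ (g⁻¹ : Equiv.Perm E) x) =
      ContinuousLinearMap.id ℂ E := by
    intro g hg
    rw [← hmul g hg g⁻¹ (H.inv_mem hg), mul_inv_cancel]
    exact fderiv_id
  refine ⟨fun y => ∑ g : H, fderiv ℂ g.1 x (g.1⁻¹ y - x), ?_, ?_, fun h hh => ?_⟩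
  · refine Finset.analyticAt_fun_sum _ fun g _ => ?_
    exact (ContinuousLinearMap.analyticAt _ _).comp
      ((han _ (H.inv_mem g.2)).sub analyticAt_const)
  · have hc : (Fintype.card H : ℂ) ≠ 0 := by
      exact_mod_cast Fintype.card_ne_zero
    refine ⟨ContinuousLinearEquiv.smulLeft (Units.mk0 _ hc), ?_⟩
    have hsum : HasFDerivAt (fun y => ∑ g : H, fderiv ℂ g.1 x (g.1⁻¹ y - x))
        (∑ g : H, (fderiv ℂ g.1 x).comp (fderiv ℂ (g.1⁻¹ : Equiv.Perm E) x)) x :=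
      HasFDerivAt.fun_sum fun g _ =>
        (fderiv ℂ g.1 x).hasFDerivAt.comp x ((hd _ (H.inv_mem g.2)).sub_const x)
    convert hsum using 1
    rw [Finset.sum_congr rfl fun g _ => hinv g.1 g.2]
    ext v
    simp [Units.smul_def, Nat.cast_smul_eq_nsmul]
  · refine ⟨fderiv ℂ h x, fun y => ?_⟩
    rw [map_sum]
    refine (Fintype.sum_equiv (Equiv.mulLeft (⟨h, hh⟩ : H)) _ _ fun g => ?_).symm
    rw [← ContinuousLinearMap.comp_apply, ← hmul h hh g.1 g.2]
    simp

/-- The inverse function theorem for analytic maps, with analyticity on the whole chart. -/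
theorem exists_openPartialHomeomorph_analyticOnNhd {E : Type*} [NormedAddCommGroup E]
    [NormedSpace ℂ E] [CompleteSpace E] {φ : E → E} {x : E} (hφ : AnalyticAt ℂ φ x)
    {f' : E ≃L[ℂ] E} (hf' : HasFDerivAt φ (f' : E →L[ℂ] E) x) :
    ∃ e : OpenPartialHomeomorph E E, x ∈ e.source ∧ ⇑e = φ ∧
      AnalyticOnNhd ℂ φ e.source ∧ AnalyticOnNhd ℂ e.symm e.target := by
  have hs : HasStrictFDerivAt φ (f' : E →L[ℂ] E) x := by
    rw [← hf'.fderiv]; exact hφ.hasStrictFDerivAt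
  set e₀ := hs.toOpenPartialHomeomorph φ
  have hx₀ : x ∈ e₀.source := hs.mem_toOpenPartialHomeomorph_source
  have hcoe : ⇑e₀ = φ := hs.toOpenPartialHomeomorph_coe
  have hsymm : AnalyticAt ℂ e₀.symm (e₀ x) := by
    refine e₀.analyticAt_symm' (i := f') hx₀ ?_ ?_
    · rw [hcoe]; exact hφ
    · rw [hcoe]; exact hf'.fderiv
  let e₁ := e₀.symm.restrOpen {z | AnalyticAt ℂ e₀.symm z} (isOpen_analyticAt ℂ _)
  let e := e₁.symm.restrOpen {z | AnalyticAt ℂ φ z} (isOpen_analyticAt ℂ _)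
  refine ⟨e, ?_, hcoe, ?_, ?_⟩
  · simp [e, e₁, hx₀, hφ, hsymm]
  · intro z hz
    exact hz.2
  · intro z hz
    exact hz.1.2

/-- A finite group of homeomorphisms of an open set `U` fixing `x` has arbitrarily small
connected open invariant neighbourhoods of `x`. -/
theorem exists_invariant_isConnected_isOpen {E : Type*} [TopologicalSpace E]
    [LocallyConnectedSpace E] (H : Subgroup (Equiv.Perm E)) [Finite H] {U W : Set E} {x : E}
    (hU : IsOpen U) (hxU : x ∈ U) (hcont : ∀ h ∈ H, ContinuousOn h U)
    (hfix : ∀ h ∈ H, h x = x) (hW : IsOpen W) (hxW : x ∈ W) :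
    ∃ V : Set E, IsOpen V ∧ IsConnected V ∧ x ∈ V ∧ V ⊆ U ∩ W ∧ ∀ h ∈ H, h '' V = V := by
  set W₁ : Set E := ⋂ h : H, U ∩ h.1 ⁻¹' (U ∩ W)
  have hW₁ : IsOpen W₁ := isOpen_iInter_of_finite fun h =>
    (hcont h.1 h.2).isOpen_inter_preimage hU (hU.inter hW)
  have hx₁ : x ∈ W₁ := mem_iInter.2 fun h => ⟨hxU, by
    rw [mem_preimage, hfix h.1 h.2]; exact ⟨hxU, hxW⟩⟩
  have hsub : W₁ ⊆ U ∩ W := fun y hy => (mem_iInter.1 hy 1).2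
  have hmaps : ∀ h ∈ H, MapsTo h W₁ W₁ := fun h hh y hy => mem_iInter.2 fun k => by
    have hk : (k.1 * h) y ∈ U ∩ W := (mem_iInter.1 hy ⟨k.1 * h, mul_mem k.2 hh⟩).2
    exact ⟨(mem_iInter.1 hy ⟨h, hh⟩).2.1, hk⟩
  have himage : ∀ h ∈ H,
      h '' connectedComponentIn W₁ x ⊆ connectedComponentIn W₁ x := fun h hh => by
    have hc : ContinuousOn h W₁ := (hcont h hh).mono fun y hy => (hsub hy).1
    refine (isPreconnected_connectedComponentIn.image h
      (hc.mono (connectedComponentIn_subset W₁ x))).subset_connectedComponentIn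
      ⟨x, mem_connectedComponentIn hx₁, hfix h hh⟩ ?_
    rintro _ ⟨y, hy, rfl⟩
    exact hmaps h hh (connectedComponentIn_subset W₁ x hy)
  refine ⟨connectedComponentIn W₁ x, hW₁.connectedComponentIn,
    isConnected_connectedComponentIn_iff.2 hx₁, mem_connectedComponentIn hx₁,
    (connectedComponentIn_subset W₁ x).trans hsub, fun h hh => (himage h hh).antisymm ?_⟩
  intro y hy
  exact ⟨h⁻¹ y, himage h⁻¹ (H.inv_mem hh) ⟨y, hy, rfl⟩, by simp⟩

/-- Finitely many continuous maps moving `x` move a whole neighbourhood of `x` off itself. -/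
theorem exists_isOpen_forall_notMem {E : Type*} [TopologicalSpace E] [T2Space E]
    {G : Set (E → E)} (hG : G.Finite) {x : E} (hcont : ∀ g ∈ G, ContinuousAt g x) :
    ∃ W : Set E, IsOpen W ∧ x ∈ W ∧ ∀ g ∈ G, g x ≠ x → ∀ y ∈ W, g y ∉ W := by
  have key : ∀ g : G, ∃ W : Set E, IsOpen W ∧ x ∈ W ∧ (g.1 x ≠ x → ∀ y ∈ W, g.1 y ∉ W) := by
    intro g
    by_cases hgx : g.1 x = x
    · exact ⟨univ, isOpen_univ, mem_univ x, fun h => absurd hgx h⟩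
    · obtain ⟨O, O', hO, hO', hxO, hxO', hdisj⟩ := t2_separation (Ne.symm hgx)
      obtain ⟨W, hWs, hW, hxW⟩ := mem_nhds_iff.1 (Filter.inter_mem (hO.mem_nhds hxO)
        ((hcont g.1 g.2).preimage_mem_nhds (hO'.mem_nhds hxO')))
      exact ⟨W, hW, hxW, fun _ y hy hgy =>
        disjoint_left.1 hdisj (hWs hgy).1 (hWs hy).2⟩
  choose W hW hxW hmove using key
  have := hG.to_subtype
  exact ⟨⋂ g, W g, isOpen_iInter_of_finite hW, mem_iInter.2 hxW, fun g hg hgx y hy hgy =>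
    hmove ⟨g, hg⟩ hgx y (mem_iInter.1 hy _) (mem_iInter.1 hgy _)⟩

namespace UniformizingSystem

variable {n : ℕ} {X : Type*} [TopologicalSpace X]

/-- The isotropy subgroup at `x`, as a group of permutations of `ℂⁿ`. -/
def isotropy (𝒰 : UniformizingSystem n X) (x : CC n) : Subgroup (Equiv.Perm (CC n)) where
  carrier := {σ | ⇑σ ∈ 𝒰.G ∧ σ x = x}
  one_mem' := ⟨𝒰.id_mem_G, rfl⟩
  mul_mem' := fun {σ τ} hσ hτ => ⟨𝒰.comp_mem_G σ hσ.1 τ hτ.1, by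
    rw [Equiv.Perm.mul_apply, hτ.2, hσ.2]⟩
  inv_mem' := fun {σ} hσ => by
    obtain ⟨g, hg, -, hr⟩ := 𝒰.inv_mem_G σ hσ.1
    have hgσ : ⇑σ⁻¹ = g := funext fun y => Equiv.Perm.inv_eq_iff_eq.2 (hr y).symm
    exact ⟨by rwa [hgσ], Equiv.Perm.inv_eq_iff_eq.2 hσ.2.symm⟩

theorem mem_isotropy {𝒰 : UniformizingSystem n X} {x : CC n} {σ : Equiv.Perm (CC n)} :
    σ ∈ 𝒰.isotropy x ↔ ⇑σ ∈ 𝒰.G ∧ σ x = x := Iff.rfl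

theorem finite_isotropy (𝒰 : UniformizingSystem n X) (x : CC n) : Finite (𝒰.isotropy x) := by
  have := 𝒰.finite_G.to_subtype
  refine Finite.of_injective (fun σ : 𝒰.isotropy x => (⟨⇑σ.1, σ.2.1⟩ : 𝒰.G)) fun σ τ h => ?_
  exact Subtype.ext (DFunLike.coe_injective (congrArg Subtype.val h))

theorem exists_mem_isotropy {𝒰 : UniformizingSystem n X} {x : CC n} {g : CC n → CC n}
    (hg : g ∈ 𝒰.G) (hgx : g x = x) : ∃ σ ∈ 𝒰.isotropy x, ⇑σ = g := by
  obtain ⟨g', -, hl, hr⟩ := 𝒰.inv_mem_G g hg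
  exact ⟨⟨g, g', hl, hr⟩, ⟨hg, hgx⟩, rfl⟩

open Classical in
/-- The uniformizing system obtained by restricting to a connected open set `V` that is invariant
under the isotropy group at `x` and moved off itself by all other elements of the group. -/
def restrictIsotropy (𝒰 : UniformizingSystem n X) (x : CC n) (V : Set (CC n)) (hV : IsOpen V)
    (hVc : IsConnected V) (hVU : V ⊆ 𝒰.Ut) (hinv : ∀ σ ∈ 𝒰.isotropy x, σ '' V = V)
    (hmove : ∀ g ∈ 𝒰.G, g x ≠ x → ∀ y ∈ V, g y ∉ V) : UniformizingSystem n X :=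
  have hmaps : ∀ σ ∈ 𝒰.isotropy x, MapsTo σ V V := fun σ hσ =>
    mapsTo_iff_image_subset.2 (hinv σ hσ).subset
  { Ut := V
    isOpen_Ut := hV
    isConnected_Ut := hVc
    G := (fun σ : Equiv.Perm (CC n) => V.piecewise σ id) '' 𝒰.isotropy x
    finite_G := (Set.finite_coe_iff.1 (𝒰.finite_isotropy x)).image _
    id_mem_G := ⟨1, one_mem _, piecewise_same V id⟩
    comp_mem_G := by
      rintro _ ⟨σ, hσ, rfl⟩ _ ⟨τ, hτ, rfl⟩
      refine ⟨σ * τ, mul_mem hσ hτ, funext fun y => ?_⟩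
      by_cases hy : y ∈ V
      · simp [hy, hmaps τ hτ hy]
      · simp [hy]
    inv_mem_G := by
      have hcancel : ∀ σ ∈ 𝒰.isotropy x, ∀ y,
          V.piecewise ⇑σ⁻¹ id (V.piecewise ⇑σ id y) = y := by
        intro σ hσ y
        by_cases hy : y ∈ V
        · simp [hy, hmaps σ hσ hy]
        · simp [hy]
      rintro _ ⟨σ, hσ, rfl⟩
      refine ⟨_, ⟨σ⁻¹, inv_mem hσ, rfl⟩, hcancel σ hσ, fun y => ?_⟩
      simpa using hcancel σ⁻¹ (inv_mem hσ) y
    mapsTo_G := by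
      rintro _ ⟨σ, hσ, rfl⟩ y hy
      simpa [hy] using hmaps σ hσ hy
    eqOn_id_G := by
      rintro _ ⟨σ, hσ, rfl⟩
      exact piecewise_eqOn_compl V _ _
    analytic_G := by
      rintro _ ⟨σ, hσ, rfl⟩
      exact ((𝒰.analytic_G σ hσ.1).mono hVU).congr hV (piecewise_eqOn V _ _).symm
    p := 𝒰.p
    continuousOn_p := 𝒰.continuousOn_p.mono hVU
    isOpen_image_p := 𝒰.isOpenMap_p V hVU hV
    invariant_p := by
      rintro _ ⟨σ, hσ, rfl⟩ y hy
      simpa [hy] using 𝒰.invariant_p σ hσ.1 y (hVU hy)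
    exists_g_of_p_eq := by
      intro y hy z hz hyz
      obtain ⟨g, hg, rfl⟩ := 𝒰.exists_g_of_p_eq y (hVU hy) z (hVU hz) hyz
      have hgx : g x = x := by
        by_contra hgx
        exact hmove g hg hgx y hy hz
      obtain ⟨σ, hσ, rfl⟩ := exists_mem_isotropy hg hgx
      exact ⟨_, ⟨σ, hσ, rfl⟩, by simp [hy]⟩
    isOpenMap_p := fun O hO => 𝒰.isOpenMap_p O (hO.trans hVU) }

end UniformizingSystem

/-- Given a uniformizing system `(Ũ, G, π)`, a point `x̃ ∈ Ũ` and an open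
neighborhood `Ã ⊆ Ũ` of `x̃`, there is a uniformizing system `(Ũ', G', π')` with
`x̃ ∈ Ũ' ⊆ Ã`, whose inclusion into `(Ũ, G, π)` is an embedding, whose group `G'`
consists exactly of the restrictions to `Ũ'` of the elements of the isotropy group
`G_{x̃}` (in particular `Ũ'` is invariant under `G_{x̃}`), and whose group acts
linearly in suitable biholomorphic coordinates. -/
theorem statement3 {n : ℕ} {X : Type*} [TopologicalSpace X]
    (𝒰 : UniformizingSystem n X) (x : CC n) (hx : x ∈ 𝒰.Ut)
    (A : Set (CC n)) (hAopen : IsOpen A) (hxA : x ∈ A) (hAU : A ⊆ 𝒰.Ut) :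
    ∃ 𝒰' : UniformizingSystem n X,
      x ∈ 𝒰'.Ut ∧ 𝒰'.Ut ⊆ A ∧
      IsUSEmbedding 𝒰' 𝒰 id ∧
      (∀ g' ∈ 𝒰'.G, ∃ g ∈ 𝒰.G, g x = x ∧ Set.EqOn g' g 𝒰'.Ut) ∧
      (∀ g ∈ 𝒰.G, g x = x → ∃ g' ∈ 𝒰'.G, Set.EqOn g' g 𝒰'.Ut) ∧
      (∀ g ∈ 𝒰.G, g x = x → g '' 𝒰'.Ut = 𝒰'.Ut) ∧
      (∃ φ ψ : CC n → CC n,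
        AnalyticOnNhd ℂ φ 𝒰'.Ut ∧ IsOpen (φ '' 𝒰'.Ut) ∧
        AnalyticOnNhd ℂ ψ (φ '' 𝒰'.Ut) ∧ (∀ y ∈ 𝒰'.Ut, ψ (φ y) = y) ∧
        ∀ g' ∈ 𝒰'.G, ∃ L : CC n →L[ℂ] CC n, ∀ y ∈ 𝒰'.Ut, φ (g' y) = L (φ y)) := by
  classical
  have hfin := 𝒰.finite_isotropy x
  have hfix : ∀ σ ∈ 𝒰.isotropy x, σ x = x := fun σ hσ => hσ.2
  obtain ⟨φ, hφ, ⟨f', hf'⟩, hlin⟩ := exists_linearization (𝒰.isotropy x) hfix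
    fun σ hσ => 𝒰.analytic_G σ hσ.1 x hx
  obtain ⟨e, hxe, rfl, he, hesymm⟩ := exists_openPartialHomeomorph_analyticOnNhd hφ hf'
  obtain ⟨W, hW, hxW, hmove⟩ := exists_isOpen_forall_notMem 𝒰.finite_G
    fun g hg => (𝒰.analytic_G g hg x hx).continuousAt
  obtain ⟨V, hV, hVc, hxV, hVsub, hinv⟩ := exists_invariant_isConnected_isOpen (𝒰.isotropy x)
    𝒰.isOpen_Ut hx (fun σ hσ => (𝒰.analytic_G σ hσ.1).continuousOn) hfix
    ((hAopen.inter hW).inter e.open_source) ⟨⟨hxA, hxW⟩, hxe⟩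
  have hVU : V ⊆ 𝒰.Ut := fun y hy => (hVsub hy).1
  have hVe : V ⊆ e.source := fun y hy => (hVsub hy).2.2
  have himage : e '' V ⊆ e.target := (image_mono hVe).trans e.image_source_eq_target.subset
  refine ⟨𝒰.restrictIsotropy x V hV hVc hVU hinv fun g hg hgx y hy hgy =>
      hmove g hg hgx y (hVsub hy).2.1.2 (hVsub hgy).2.1.2,
    hxV, fun y hy => (hVsub hy).2.1.1, ?_, ?_, ?_, ?_,
    e, e.symm, he.mono hVe, e.isOpen_image_of_subset_source hV hVe, hesymm.mono himage,
    fun y hy => e.left_inv (hVe hy), ?_⟩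
  · refine ⟨hVU, injOn_id _, analyticOnNhd_id, ?_,
      ⟨id, analyticOnNhd_id, fun _ _ => rfl⟩, fun _ _ => rfl⟩
    rw [image_id]
    exact hV
  · rintro _ ⟨σ, hσ, rfl⟩
    exact ⟨σ, hσ.1, hσ.2, piecewise_eqOn V _ _⟩
  · intro g hg hgx
    obtain ⟨σ, hσ, rfl⟩ := UniformizingSystem.exists_mem_isotropy hg hgx
    exact ⟨_, ⟨σ, hσ, rfl⟩, piecewise_eqOn V _ _⟩
  · intro g hg hgx
    obtain ⟨σ, hσ, rfl⟩ := UniformizingSystem.exists_mem_isotropy hg hgx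
    exact hinv σ hσ
  · rintro _ ⟨σ, hσ, rfl⟩
    obtain ⟨L, hL⟩ := hlin σ hσ
    refine ⟨L, fun y hy => ?_⟩
    rw [← hL y]
    exact congrArg e (piecewise_eqOn V _ _ hy)
end
end

section
/- Let λ and μ be two embeddings (Ũ, G, π) → (Ṽ, H, φ) between uniformizing systems of the same dimension n. Then there exists a unique h ∈ H such that μ = h ∘ λ. -/
open Set

noncomputable section

namespace UniformizingSystem

variable {n : ℕ} {X : Type*} [TopologicalSpace X]

/-- Two group elements agreeing on a nonempty open subset of the domain are equal. -/
theorem eq_of_eqOn_isOpen (𝒱 : UniformizingSystem n X) {g h : CC n → CC n}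
    (hg : g ∈ 𝒱.G) (hh : h ∈ 𝒱.G) {W : Set (CC n)} (hWo : IsOpen W) (hW : W ⊆ 𝒱.Ut)
    (hne : W.Nonempty) (hgh : EqOn g h W) : g = h := by
  obtain ⟨z, hz⟩ := hne
  have key : EqOn g h 𝒱.Ut :=
    (𝒱.analytic_G g hg).eqOn_of_preconnected_of_eventuallyEq (𝒱.analytic_G h hh)
      𝒱.isConnected_Ut.isPreconnected (hW hz) (hgh.eventuallyEq_of_mem (hWo.mem_nhds hz))
  funext x
  by_cases hx : x ∈ 𝒱.Ut
  · exact key hx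
  · exact (𝒱.eqOn_id_G g hg hx).trans (𝒱.eqOn_id_G h hh hx).symm

end UniformizingSystem

/-- If, on a nonempty connected open set, an analytic map agrees at each point with one of
countably many analytic maps, then it agrees with one of them everywhere. -/
theorem AnalyticOnNhd.exists_eqOn_of_forall_exists_eq {E F ι : Type*} [NormedAddCommGroup E]
    [NormedSpace ℂ E] [CompleteSpace E] [NormedAddCommGroup F] [NormedSpace ℂ F] [Countable ι]
    {U : Set E} (hUo : IsOpen U) (hUc : IsConnected U) {f : E → F} {g : ι → E → F}
    (hf : AnalyticOnNhd ℂ f U) (hg : ∀ i, AnalyticOnNhd ℂ (g i) U)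
    (hfg : ∀ x ∈ U, ∃ i, f x = g i x) : ∃ i, EqOn f (g i) U := by
  have : BaireSpace U := hUo.baireSpace
  have : Nonempty U := hUc.nonempty.to_subtype
  obtain ⟨i, z, hz⟩ := nonempty_interior_of_iUnion_of_closed
    (f := fun i => {x : U | f x = g i x})
    (fun i => isClosed_eq hf.continuousOn.domRestrict (hg i).continuousOn.domRestrict)
    (by
      ext x
      simpa using hfg x x.2)
  refine ⟨i, hf.eqOn_of_preconnected_of_eventuallyEq (hg i) hUc.isPreconnected z.2 ?_⟩
  have hz' := mem_interior_iff_mem_nhds.1 hz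
  rw [Filter.EventuallyEq, ← hUo.isOpenEmbedding_subtypeVal.map_nhds_eq z, Filter.eventually_map]
  exact hz'

/-- If `l` (i.e. `λ`) and `m` (i.e. `μ`) are two embeddings of uniformizing systems
`(Ũ, G, π) → (Ṽ, H, φ)`, there is a unique `h ∈ H` with `μ = h ∘ λ` (as maps on `Ũ`). -/
theorem statement4 {n : ℕ} {X : Type*} [TopologicalSpace X]
    (𝒰 𝒱 : UniformizingSystem n X) (l m : CC n → CC n)
    (hl : IsUSEmbedding 𝒰 𝒱 l) (hm : IsUSEmbedding 𝒰 𝒱 m) :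
    ∃! h : CC n → CC n, h ∈ 𝒱.G ∧ ∀ x ∈ 𝒰.Ut, m x = h (l x) := by
  have hex : ∃ h : 𝒱.G, EqOn m (fun x => h.1 (l x)) 𝒰.Ut := by
    have : Countable 𝒱.G := 𝒱.finite_G.countable.to_subtype
    refine AnalyticOnNhd.exists_eqOn_of_forall_exists_eq 𝒰.isOpen_Ut 𝒰.isConnected_Ut
      hm.analyticOn (fun h => (𝒱.analytic_G h.1 h.2).comp hl.analyticOn hl.mapsTo) ?_
    intro x hx
    obtain ⟨h, hh, hhx⟩ := 𝒱.exists_g_of_p_eq (l x) (hl.mapsTo hx) (m x) (hm.mapsTo hx)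
      ((hl.comp_p x hx).trans (hm.comp_p x hx).symm)
    exact ⟨⟨h, hh⟩, hhx.symm⟩
  obtain ⟨⟨h, hh⟩, hml⟩ := hex
  refine ⟨h, ⟨hh, hml⟩, ?_⟩
  rintro k ⟨hk, hmk⟩
  refine 𝒱.eq_of_eqOn_isOpen hk hh hl.isOpen_image hl.mapsTo.image_subset
    (𝒰.isConnected_Ut.nonempty.image l) ?_
  rintro _ ⟨x, hx, rfl⟩
  exact (hmk x hx).symm.trans (hml hx)
end
end

section
/- Let λ : (Ũ, G, π) → (Ṽ, H, φ) be an embedding between uniformizing systems of the same dimension n. Then for every g ∈ G there is a unique element Λ(g) ∈ H with λ ∘ g = Λ(g) ∘ λ, and the resulting map Λ : G → H is an injective group homomorphism. -/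
open Set

noncomputable section

/-- Analytic maps on a connected open set, finitely many pairs of which cover it by their
coincidence sets: one of the pairs coincides everywhere. -/
theorem exists_eqOn_of_finite_cover {n : ℕ} {U : Set (CC n)} (hU : IsOpen U)
    (hc : IsConnected U) {S : Set (CC n → CC n)} (hS : S.Finite)
    {f l : CC n → CC n} (hf : AnalyticOnNhd ℂ f U)
    (hl : ∀ h ∈ S, AnalyticOnNhd ℂ (h ∘ l) U)
    (hcov : ∀ x ∈ U, ∃ h ∈ S, h (l x) = f x) :
    ∃ h ∈ S, EqOn f (h ∘ l) U := by
  have : Finite S := hS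
  have : BaireSpace U := hU.baireSpace
  have : Nonempty U := hc.nonempty.to_subtype
  let F : S → Set U := fun h => {x | (h.1 ∘ l) x = f x}
  have hF : ∀ h, IsClosed (F h) := fun h =>
    isClosed_eq (hl h.1 h.2).continuousOn.domRestrict hf.continuousOn.domRestrict
  have hcovF : ⋃ h, F h = univ := by
    refine eq_univ_of_forall fun x => ?_
    obtain ⟨h, hh, e⟩ := hcov x x.2
    exact mem_iUnion.2 ⟨⟨h, hh⟩, e⟩
  obtain ⟨h, x, hx⟩ := nonempty_interior_of_iUnion_of_closed hF hcovF
  refine ⟨h.1, h.2, hf.eqOn_of_preconnected_of_eventuallyEq (hl h.1 h.2)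
    hc.isPreconnected x.2 ?_⟩
  have hn : F h ∈ nhds x := mem_interior_iff_mem_nhds.1 hx
  have hm : Subtype.val '' F h ∈ nhds (x : CC n) := hU.isOpenMap_subtype_val.image_mem_nhds hn
  filter_upwards [hm]
  rintro _ ⟨y, hy, rfl⟩
  exact Eq.symm hy

/-- Two elements of the group of a uniformizing system that agree on a nonempty open subset
are equal. -/
theorem UniformizingSystem.eq_of_eqOn_open {n : ℕ} {X : Type*} [TopologicalSpace X]
    (𝒱 : UniformizingSystem n X) {h k : CC n → CC n} (hh : h ∈ 𝒱.G) (hk : k ∈ 𝒱.G)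
    {W : Set (CC n)} (hW : IsOpen W) (hne : W.Nonempty) (hWV : W ⊆ 𝒱.Ut)
    (e : EqOn h k W) : h = k := by
  obtain ⟨y, hy⟩ := hne
  have heq := (𝒱.analytic_G h hh).eqOn_of_preconnected_of_eventuallyEq (𝒱.analytic_G k hk)
    𝒱.isConnected_Ut.isPreconnected (hWV hy) (e.eventuallyEq_of_mem (hW.mem_nhds hy))
  funext z
  by_cases hz : z ∈ 𝒱.Ut
  · exact heq hz
  · rw [𝒱.eqOn_id_G h hh hz, 𝒱.eqOn_id_G k hk hz]

/-- Any embedding `l : (Ũ, G, π) → (Ṽ, H, φ)` induces an injective group homomorphism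
`Λ : G → H`, where `Λ g` is the unique element of `H` with `l ∘ g = Λ(g) ∘ l` on `Ũ`. -/
theorem statement5 {n : ℕ} {X : Type*} [TopologicalSpace X]
    (𝒰 𝒱 : UniformizingSystem n X) (l : CC n → CC n)
    (hl : IsUSEmbedding 𝒰 𝒱 l) :
    ∃ Λ : (CC n → CC n) → (CC n → CC n),
      (∀ g ∈ 𝒰.G, Λ g ∈ 𝒱.G ∧ ∀ x ∈ 𝒰.Ut, l (g x) = Λ g (l x)) ∧
      (∀ g ∈ 𝒰.G, ∀ h ∈ 𝒱.G, (∀ x ∈ 𝒰.Ut, l (g x) = h (l x)) → h = Λ g) ∧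
      Set.InjOn Λ 𝒰.G ∧
      (∀ g ∈ 𝒰.G, ∀ g' ∈ 𝒰.G, Λ (g ∘ g') = Λ g ∘ Λ g') := by
  have ex : ∀ g ∈ 𝒰.G, ∃ h ∈ 𝒱.G, EqOn (l ∘ g) (h ∘ l) 𝒰.Ut := fun g hg =>
    exists_eqOn_of_finite_cover 𝒰.isOpen_Ut 𝒰.isConnected_Ut 𝒱.finite_G
      (hl.analyticOn.comp (𝒰.analytic_G g hg) (𝒰.mapsTo_G g hg))
      (fun h hh => (𝒱.analytic_G h hh).comp hl.analyticOn hl.mapsTo)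
      (fun x hx => 𝒱.exists_g_of_p_eq _ (hl.mapsTo hx) _ (hl.mapsTo (𝒰.mapsTo_G g hg hx))
        (by rw [hl.comp_p x hx, Function.comp_apply, hl.comp_p _ (𝒰.mapsTo_G g hg hx),
          𝒰.invariant_p g hg x hx]))
  have uniq : ∀ h ∈ 𝒱.G, ∀ k ∈ 𝒱.G, (∀ x ∈ 𝒰.Ut, h (l x) = k (l x)) → h = k :=
    fun h hh k hk e => 𝒱.eq_of_eqOn_open hh hk hl.isOpen_image
      (𝒰.isConnected_Ut.nonempty.image l) hl.mapsTo.image_subset (forall_mem_image.2 e)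
  choose! Λ hΛ hΛl using ex
  refine ⟨Λ, fun g hg => ⟨hΛ g hg, hΛl g hg⟩, fun g hg h hh e =>
    uniq h hh _ (hΛ g hg) fun x hx => (e x hx).symm.trans (hΛl g hg hx), ?_, ?_⟩
  · intro g hg g' hg' e
    refine 𝒰.eq_of_eqOn_open hg hg' 𝒰.isOpen_Ut 𝒰.isConnected_Ut.nonempty subset_rfl ?_
    intro x hx
    refine hl.injOn (𝒰.mapsTo_G g hg hx) (𝒰.mapsTo_G g' hg' hx) ?_
    exact (hΛl g hg hx).trans ((congrFun e (l x)).trans (hΛl g' hg' hx).symm)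
  · intro g hg g' hg'
    have hgg := 𝒰.comp_mem_G g hg g' hg'
    refine uniq _ (hΛ _ hgg) _ (𝒱.comp_mem_G _ (hΛ g hg) _ (hΛ g' hg')) fun x hx => ?_
    calc Λ (g ∘ g') (l x) = l (g (g' x)) := (hΛl _ hgg hx).symm
      _ = Λ g (l (g' x)) := hΛl g hg (𝒰.mapsTo_G g' hg' hx)
      _ = Λ g (Λ g' (l x)) := congrArg (Λ g) (hΛl g' hg' hx)
end
end

section
/- Let λ : (Ũ, G, π) → (Ṽ, H, φ) be an embedding between uniformizing systems of the same dimension n, let Λ : G → H be the induced injective group homomorphism (characterized by λ ∘ g = Λ(g) ∘ λ for all g ∈ G), and let h ∈ H. If h(λ(Ũ)) ∩ λ(Ũ) ≠ ∅, then h(λ(Ũ)) = λ(Ũ) and h belongs to the image Λ(G). -/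
open Set

noncomputable section

/-- If two maps of the group of a uniformizing system agree near a point of its domain,
then they are equal. -/
theorem UniformizingSystem.eq_of_eventuallyEq {n : ℕ} {X : Type*} [TopologicalSpace X]
    (𝒱 : UniformizingSystem n X) {f k : CC n → CC n} (hf : f ∈ 𝒱.G) (hk : k ∈ 𝒱.G)
    {z : CC n} (hz : z ∈ 𝒱.Ut) (hfk : f =ᶠ[nhds z] k) : f = k := by
  have hon : Set.EqOn f k 𝒱.Ut :=
    (𝒱.analytic_G f hf).eqOn_of_preconnected_of_eventuallyEq (𝒱.analytic_G k hk)
      𝒱.isConnected_Ut.isPreconnected hz hfk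
  funext x
  by_cases hx : x ∈ 𝒱.Ut
  · exact hon hx
  · rw [𝒱.eqOn_id_G f hf hx, 𝒱.eqOn_id_G k hk hx]

/-- If every point of a nonempty open set `W` of the domain has the same image under `k` as under
some member of a finite family `S` of elements of the group, then `k` belongs to `S`. -/
theorem UniformizingSystem.mem_of_forall_exists_eq {n : ℕ} {X : Type*} [TopologicalSpace X]
    (𝒱 : UniformizingSystem n X) {S : Set (CC n → CC n)} (hS : S ⊆ 𝒱.G)
    {k : CC n → CC n} (hk : k ∈ 𝒱.G) {W : Set (CC n)} (hWo : IsOpen W) (hWV : W ⊆ 𝒱.Ut)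
    (hWne : W.Nonempty) (hW : ∀ z ∈ W, ∃ f ∈ S, f z = k z) : k ∈ S := by
  have : BaireSpace W := hWo.baireSpace
  have : Nonempty W := hWne.to_subtype
  have : Countable S := (𝒱.finite_G.subset hS).countable.to_subtype
  have hcont : ∀ f ∈ 𝒱.G, Continuous fun z : W => f z := fun f hf =>
    (((𝒱.analytic_G f hf).continuousOn).mono hWV).domRestrict
  obtain ⟨⟨f, hf⟩, z, hz⟩ := nonempty_interior_of_iUnion_of_closed
    (f := fun f : S => {z : W | f.1 z = k z})
    (fun f => isClosed_eq (hcont f.1 (hS f.2)) (hcont k hk))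
    (by
      refine Set.eq_univ_of_forall fun z => Set.mem_iUnion.2 ?_
      obtain ⟨f, hf, hfz⟩ := hW z z.2
      exact ⟨⟨f, hf⟩, hfz⟩)
  have hev : f =ᶠ[nhds (z : CC n)] k := by
    rw [← hWo.isOpenEmbedding_subtypeVal.map_nhds_eq z]
    exact Filter.eventually_map.2 (mem_interior_iff_mem_nhds.1 hz)
  exact 𝒱.eq_of_eventuallyEq (hS hf) hk (hWV z.2) hev ▸ hf

/-- Let `l : (Ũ, G, π) → (Ṽ, H, φ)` be an embedding, `Λ : G → H` the induced injective
group homomorphism, and `h ∈ H`. If `h(l(Ũ))` meets `l(Ũ)`, then `h(l(Ũ)) = l(Ũ)` and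
`h` lies in the image `Λ(G)`. -/
theorem statement6 {n : ℕ} {X : Type*} [TopologicalSpace X]
    (𝒰 𝒱 : UniformizingSystem n X) (l : CC n → CC n)
    (hl : IsUSEmbedding 𝒰 𝒱 l)
    (Λ : (CC n → CC n) → (CC n → CC n))
    (hΛmem : ∀ g ∈ 𝒰.G, Λ g ∈ 𝒱.G)
    (hΛeq : ∀ g ∈ 𝒰.G, ∀ x ∈ 𝒰.Ut, l (g x) = Λ g (l x))
    (hΛinj : Set.InjOn Λ 𝒰.G)
    (hΛhom : ∀ g ∈ 𝒰.G, ∀ g' ∈ 𝒰.G, Λ (g ∘ g') = Λ g ∘ Λ g')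
    (h : CC n → CC n) (hh : h ∈ 𝒱.G)
    (hmeet : (h '' (l '' 𝒰.Ut) ∩ l '' 𝒰.Ut).Nonempty) :
    h '' (l '' 𝒰.Ut) = l '' 𝒰.Ut ∧ ∃ g ∈ 𝒰.G, Λ g = h := by
  have hlV : l '' 𝒰.Ut ⊆ 𝒱.Ut := hl.mapsTo.image_subset
  have hhc : ContinuousOn h (l '' 𝒰.Ut) := (𝒱.analytic_G h hh).continuousOn.mono hlV
  have hmem : h ∈ Λ '' 𝒰.G := by
    refine 𝒱.mem_of_forall_exists_eq (Set.image_subset_iff.2 hΛmem) hh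
      (hhc.isOpen_inter_preimage hl.isOpen_image hl.isOpen_image)
      (Set.inter_subset_left.trans hlV) ?_ ?_
    · obtain ⟨_, ⟨z, hz, rfl⟩, hhz⟩ := hmeet
      exact ⟨z, hz, hhz⟩
    · rintro _ ⟨⟨x, hx, rfl⟩, y, hy, hxy⟩
      obtain ⟨g, hg, rfl⟩ := 𝒰.exists_g_of_p_eq x hx y hy (by
        rw [← hl.comp_p x hx, ← hl.comp_p y hy, hxy, 𝒱.invariant_p h hh _ (hl.mapsTo hx)])
      exact ⟨Λ g, ⟨g, hg, rfl⟩, by rw [← hΛeq g hg x hx, hxy]⟩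
  obtain ⟨g, hg, rfl⟩ := hmem
  refine ⟨?_, g, hg, rfl⟩
  obtain ⟨g', hg', -, hgg'⟩ := 𝒰.inv_mem_G g hg
  refine Set.Subset.antisymm ?_ ?_
  · rintro _ ⟨_, ⟨x, hx, rfl⟩, rfl⟩
    exact ⟨g x, 𝒰.mapsTo_G g hg hx, hΛeq g hg x hx⟩
  · rintro _ ⟨x, hx, rfl⟩
    have hx' := 𝒰.mapsTo_G g' hg' hx
    exact ⟨l (g' x), ⟨g' x, hx', rfl⟩, by rw [← hΛeq g hg _ hx', hgg']⟩
end
end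

section
/- Let λ : (Ũ, G, π) → (Ṽ, H, φ) be an embedding between uniformizing systems of the same dimension n, with induced injective group homomorphism Λ : G → H (characterized by λ ∘ g = Λ(g) ∘ λ for all g ∈ G). Let x̃ ∈ Ũ and set ỹ := λ(x̃). Then Λ maps the isotropy subgroup G_{x̃} into H_{ỹ}, and its restriction is a group isomorphism from G_{x̃} onto H_{ỹ}. -/
open Set

noncomputable section

/-- If a continuous map on a nonempty open subset of a Baire space agrees at every point with one
of countably many continuous maps, then it agrees with one of them near some point. -/
theorem IsOpen.exists_eventuallyEq_of_forall_exists_eq {E F : Type*} [TopologicalSpace E]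
    [BaireSpace E] [TopologicalSpace F] [T2Space F] {W : Set E} (hW : IsOpen W)
    (hne : W.Nonempty) {S : Set (E → F)} (hS : S.Countable) {f : E → F}
    (hf : ContinuousOn f W) (hg : ∀ g ∈ S, ContinuousOn g W)
    (h : ∀ w ∈ W, ∃ g ∈ S, f w = g w) :
    ∃ g ∈ S, ∃ w ∈ W, f =ᶠ[nhds w] g := by
  have := hW.baireSpace
  have := hne.to_subtype
  have := hS.to_subtype
  obtain ⟨⟨g, hgS⟩, w, hw⟩ := nonempty_interior_of_iUnion_of_closed
    (f := fun g : S => {w : W | f w = g.1 w})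
    (fun g => isClosed_eq hf.domRestrict (hg g g.2).domRestrict)
    (eq_univ_of_forall fun w => by
      obtain ⟨g, hgS, hgw⟩ := h w w.2
      exact mem_iUnion.2 ⟨⟨g, hgS⟩, hgw⟩)
  refine ⟨g, hgS, w, w.2, ?_⟩
  have hev : ∀ᶠ v : W in nhds w, f v = g v := mem_interior_iff_mem_nhds.1 hw
  rw [nhds_subtype_eq_comap] at hev
  filter_upwards [Filter.eventually_comap.1 hev, hW.mem_nhds w.2] with v hv hvW
  exact hv ⟨v, hvW⟩ rfl

/-- Two elements of the group of a uniformizing system that agree near a point of its domain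
are equal. -/
theorem UniformizingSystem.eq_of_eventuallyEq_s7 {n : ℕ} {X : Type*} [TopologicalSpace X]
    (𝒰 : UniformizingSystem n X) {g h : CC n → CC n} (hg : g ∈ 𝒰.G) (hh : h ∈ 𝒰.G)
    {w : CC n} (hw : w ∈ 𝒰.Ut) (hgh : g =ᶠ[nhds w] h) : g = h := by
  funext v
  by_cases hv : v ∈ 𝒰.Ut
  · exact (𝒰.analytic_G g hg).eqOn_of_preconnected_of_eventuallyEq (𝒰.analytic_G h hh)
      𝒰.isConnected_Ut.isPreconnected hw hgh hv
  · exact (𝒰.eqOn_id_G g hg hv).trans (𝒰.eqOn_id_G h hh hv).symm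

/-- An element of `H` that maps some point of the image of an embedding into that image is
induced by an element of `G`. -/
theorem IsUSEmbedding.exists_eq_of_mem_image {n : ℕ} {X : Type*} [TopologicalSpace X]
    {𝒰 𝒱 : UniformizingSystem n X} {l : CC n → CC n} (hl : IsUSEmbedding 𝒰 𝒱 l)
    {Λ : (CC n → CC n) → (CC n → CC n)} (hΛmem : ∀ g ∈ 𝒰.G, Λ g ∈ 𝒱.G)
    (hΛeq : ∀ g ∈ 𝒰.G, ∀ x ∈ 𝒰.Ut, l (g x) = Λ g (l x))
    {h : CC n → CC n} (hh : h ∈ 𝒱.G) {y : CC n} (hy : y ∈ l '' 𝒰.Ut)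
    (hhy : h y ∈ l '' 𝒰.Ut) : ∃ g ∈ 𝒰.G, Λ g = h := by
  have hsub : l '' 𝒰.Ut ⊆ 𝒱.Ut := hl.mapsTo.image_subset
  have hcont : ∀ k ∈ 𝒱.G, ContinuousOn k (l '' 𝒰.Ut) := fun k hk =>
    (𝒱.analytic_G k hk).continuousOn.mono hsub
  have hW : IsOpen (l '' 𝒰.Ut ∩ h ⁻¹' (l '' 𝒰.Ut)) :=
    (hcont h hh).isOpen_inter_preimage hl.isOpen_image hl.isOpen_image
  obtain ⟨_, ⟨g, hg, rfl⟩, w, hw, hev⟩ := hW.exists_eventuallyEq_of_forall_exists_eq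
    ⟨y, hy, hhy⟩ (𝒰.finite_G.image Λ).countable ((hcont h hh).mono inter_subset_left)
    (forall_mem_image.2 fun g hg => (hcont _ (hΛmem g hg)).mono inter_subset_left)
    (by
      rintro _ ⟨⟨z, hz, rfl⟩, z', hz', hzz'⟩
      have hp : 𝒰.p z = 𝒰.p z' := by
        rw [← hl.comp_p z hz, ← hl.comp_p z' hz', hzz', 𝒱.invariant_p h hh _ (hl.mapsTo hz)]
      obtain ⟨g, hg, rfl⟩ := 𝒰.exists_g_of_p_eq z hz z' hz' hp
      exact ⟨Λ g, mem_image_of_mem Λ hg, hzz'.symm.trans (hΛeq g hg z hz)⟩)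
  exact ⟨g, hg, 𝒱.eq_of_eventuallyEq_s7 (hΛmem g hg) hh (hsub hw.1) hev.symm⟩

/-- Let `l : (Ũ, G, π) → (Ṽ, H, φ)` be an embedding, `Λ : G → H` the induced injective
group homomorphism, `x̃ ∈ Ũ` and `ỹ := l(x̃)`. Then `Λ` restricts to a group
isomorphism (a multiplicative bijection) from the isotropy group `G_{x̃}` onto `H_{ỹ}`. -/
theorem statement7 {n : ℕ} {X : Type*} [TopologicalSpace X]
    (𝒰 𝒱 : UniformizingSystem n X) (l : CC n → CC n)
    (hl : IsUSEmbedding 𝒰 𝒱 l)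
    (Λ : (CC n → CC n) → (CC n → CC n))
    (hΛmem : ∀ g ∈ 𝒰.G, Λ g ∈ 𝒱.G)
    (hΛeq : ∀ g ∈ 𝒰.G, ∀ x ∈ 𝒰.Ut, l (g x) = Λ g (l x))
    (hΛinj : Set.InjOn Λ 𝒰.G)
    (hΛhom : ∀ g ∈ 𝒰.G, ∀ g' ∈ 𝒰.G, Λ (g ∘ g') = Λ g ∘ Λ g')
    (x : CC n) (hx : x ∈ 𝒰.Ut) :
    Set.BijOn Λ {g ∈ 𝒰.G | g x = x} {h ∈ 𝒱.G | h (l x) = l x} := by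
  refine ⟨fun g hg => ⟨hΛmem g hg.1, ?_⟩, hΛinj.mono (sep_subset _ _), fun h hh => ?_⟩
  · rw [← hΛeq g hg.1 x hx, hg.2]
  · have hlx : l x ∈ l '' 𝒰.Ut := mem_image_of_mem l hx
    obtain ⟨g, hg, rfl⟩ := hl.exists_eq_of_mem_image hΛmem hΛeq hh.1 hlx (hh.2.symm ▸ hlx)
    exact ⟨g, ⟨hg, hl.injOn (𝒰.mapsTo_G g hg hx) hx ((hΛeq g hg x hx).trans hh.2)⟩, rfl⟩
end
end

section
/- Define two orbifold atlases U and V of dimension n on the same space X to be equivalent at a point x ∈ X iff there exist a uniformizing system (W̃, K, ξ) of dimension n for an open neighborhood of x (not required to belong to U or V), charts (Ũ_i, G_i, π_i) ∈ U and (Ṽ_j, H_j, φ_j) ∈ V, and embeddings (Ũ_i, G_i, π_i) ← (W̃, K, ξ) → (Ṽ_j, H_j, φ_j); define U and V to be equivalent iff they are equivalent at every point of X. Then this is an equivalence relation on the set of orbifold atlases of dimension n on X. -/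
open Set

noncomputable section

/-- A (reduced complex) orbifold atlas of dimension `n` on `X`: a family of
uniformizing systems whose underlying open sets cover `X`, such that any two charts
are compatible at every point of the intersection of their underlying open sets. -/
structure OrbifoldAtlas (n : ℕ) (X : Type*) [TopologicalSpace X] where
  I : Type
  chart : I → UniformizingSystem n X
  covers : ∀ x : X, ∃ i : I, x ∈ (chart i).U
  compat : ∀ i j : I, ∀ x ∈ (chart i).U ∩ (chart j).U,
    ∃ k : I, x ∈ (chart k).U ∧ (chart k).U ⊆ (chart i).U ∩ (chart j).U ∧
      (∃ l, IsUSEmbedding (chart k) (chart i) l) ∧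
      (∃ l, IsUSEmbedding (chart k) (chart j) l)

/-- Two orbifold atlases on `X` are equivalent at `x ∈ X` iff some uniformizing system
whose underlying open set contains `x` embeds into a chart of each atlas. -/
def AtlasEquivAt {n : ℕ} {X : Type*} [TopologicalSpace X]
    (𝒰 𝒱 : OrbifoldAtlas n X) (x : X) : Prop :=
  ∃ (W : UniformizingSystem n X) (i : 𝒰.I) (j : 𝒱.I) (l l' : CC n → CC n),
    x ∈ W.U ∧ IsUSEmbedding W (𝒰.chart i) l ∧ IsUSEmbedding W (𝒱.chart j) l'

/-- Two orbifold atlases on `X` are equivalent iff they are equivalent at every point. -/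
def AtlasEquiv {n : ℕ} {X : Type*} [TopologicalSpace X]
    (𝒰 𝒱 : OrbifoldAtlas n X) : Prop :=
  ∀ x : X, AtlasEquivAt 𝒰 𝒱 x

open Filter Topology in
/-- Small neighbourhoods of a point `y` on which only the stabilizer of `y` acts. -/
theorem UniformizingSystem.exists_invariant_nhd {n : ℕ} {X : Type*} [TopologicalSpace X]
    (𝒰 : UniformizingSystem n X) {y : CC n} (hy : y ∈ 𝒰.Ut) {N : Set (CC n)} (hN : N ∈ 𝓝 y) :
    ∃ D ⊆ 𝒰.Ut, D ⊆ N ∧ y ∈ D ∧ IsOpen D ∧ IsConnected D ∧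
      ∀ g ∈ 𝒰.G, ∀ x ∈ D, g x ∈ D → MapsTo g D D := by
  have hcont : ∀ g ∈ 𝒰.G, ContinuousOn g 𝒰.Ut := fun g hg => (𝒰.analytic_G g hg).continuousOn
  have hsep : ∀ᶠ z in 𝓝 y ×ˢ 𝓝 y, ∀ g ∈ 𝒰.G, g y ≠ y → g z.1 ≠ z.2 := by
    rw [eventually_all_finite 𝒰.finite_G]
    intro g hg
    by_cases hgy : g y = y
    · exact Eventually.of_forall fun z h => absurd hgy h
    · have h1 : Tendsto (fun z : CC n × CC n => g z.1) (𝓝 y ×ˢ 𝓝 y) (𝓝 (g y)) :=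
        ((hcont g hg).continuousAt (𝒰.isOpen_Ut.mem_nhds hy)).tendsto.comp tendsto_fst
      filter_upwards [(h1.prodMk_nhds tendsto_snd).eventually
        (isClosed_diagonal.isOpen_compl.mem_nhds hgy)] with z hz _ using hz
  obtain ⟨t, ht, htsep⟩ := eventually_prod_self_iff'.1 hsep
  set O := interior (t ∩ N)
  have hyO : y ∈ O := mem_interior_iff_mem_nhds.2 (inter_mem ht hN)
  set S := {g ∈ 𝒰.G | g y = y}
  set M := 𝒰.Ut ∩ ⋂ g ∈ S, (𝒰.Ut ∩ g ⁻¹' O)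
  have hMo : IsOpen M := 𝒰.isOpen_Ut.inter <|
    (𝒰.finite_G.subset (sep_subset _ _)).isOpen_biInter fun g hg =>
      (hcont g hg.1).isOpen_inter_preimage 𝒰.isOpen_Ut isOpen_interior
  have hMU : M ⊆ 𝒰.Ut := inter_subset_left
  have hM : ∀ x, x ∈ M ↔ x ∈ 𝒰.Ut ∧ ∀ g ∈ S, g x ∈ O := fun x => by
    simp only [M, mem_inter_iff, mem_iInter, mem_preimage]
    exact ⟨fun h => ⟨h.1, fun g hg => (h.2 g hg).2⟩, fun h => ⟨h.1, fun g hg => ⟨h.1, h.2 g hg⟩⟩⟩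
  have hMO : M ⊆ t ∩ N := fun x hx =>
    interior_subset (((hM x).1 hx).2 id ⟨𝒰.id_mem_G, rfl⟩)
  have hyM : y ∈ M := (hM y).2 ⟨hy, fun g hg => by rwa [hg.2]⟩
  have hMinv : ∀ g ∈ S, MapsTo g M M := fun g hg x hx =>
    (hM _).2 ⟨𝒰.mapsTo_G g hg.1 (hMU hx), fun k hk =>
      ((hM x).1 hx).2 (k ∘ g) ⟨𝒰.comp_mem_G k hk.1 g hg.1, by simp [hg.2, hk.2]⟩⟩
  have hDM : connectedComponentIn M y ⊆ M := connectedComponentIn_subset M y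
  have hyD : y ∈ connectedComponentIn M y := mem_connectedComponentIn hyM
  refine ⟨connectedComponentIn M y, hDM.trans hMU, fun x hx => (hMO (hDM hx)).2, hyD,
    hMo.connectedComponentIn, ⟨⟨y, hyD⟩, isPreconnected_connectedComponentIn⟩, ?_⟩
  intro g hg x hx hgx
  have hgy : g y = y := by
    by_contra hne
    exact htsep x (hMO (hDM hx)).1 (g x) (hMO (hDM hgx)).1 g hg hne rfl
  rw [mapsTo_iff_image_subset]
  exact (isPreconnected_connectedComponentIn.image g
    ((hcont g hg).mono (hDM.trans hMU))).subset_connectedComponentIn ⟨y, hyD, hgy⟩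
    (((hMinv g ⟨hg, hgy⟩).mono_left hDM).image_subset)

open scoped Classical in
/-- Restriction of a uniformizing system to a connected open set each of whose translates is
either itself or disjoint from it. -/
def UniformizingSystem.restrict {n : ℕ} {X : Type*} [TopologicalSpace X]
    (𝒰 : UniformizingSystem n X) (D : Set (CC n)) (hDU : D ⊆ 𝒰.Ut) (hDo : IsOpen D)
    (hDc : IsConnected D) (hD : ∀ g ∈ 𝒰.G, ∀ x ∈ D, g x ∈ D → MapsTo g D D) :
    UniformizingSystem n X where
  Ut := D
  isOpen_Ut := hDo
  isConnected_Ut := hDc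
  G := (fun g => D.piecewise g id) '' {g ∈ 𝒰.G | MapsTo g D D}
  finite_G := (𝒰.finite_G.subset (sep_subset _ _)).image _
  id_mem_G := ⟨id, ⟨𝒰.id_mem_G, mapsTo_id D⟩, by simp⟩
  comp_mem_G := by
    rintro _ ⟨g, ⟨hg, hgD⟩, rfl⟩ _ ⟨h, ⟨hh, hhD⟩, rfl⟩
    refine ⟨g ∘ h, ⟨𝒰.comp_mem_G g hg h hh, hgD.comp hhD⟩, ?_⟩
    funext x
    by_cases hx : x ∈ D
    · simp [hx, hhD hx]
    · simp [hx]
  inv_mem_G := by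
    rintro _ ⟨g, ⟨hg, hgD⟩, rfl⟩
    obtain ⟨g', hg', h1, h2⟩ := 𝒰.inv_mem_G g hg
    obtain ⟨x₀, hx₀⟩ := hDc.nonempty
    have hgD' : MapsTo g' D D := hD g' hg' (g x₀) (hgD hx₀) (by rwa [h1])
    refine ⟨_, ⟨g', ⟨hg', hgD'⟩, rfl⟩, fun x => ?_, fun x => ?_⟩
    · by_cases hx : x ∈ D
      · simp [hx, hgD hx, h1]
      · simp [hx]
    · by_cases hx : x ∈ D
      · simp [hx, hgD' hx, h2]
      · simp [hx]
  mapsTo_G := by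
    rintro _ ⟨g, ⟨hg, hgD⟩, rfl⟩ x hx
    simpa [hx] using hgD hx
  eqOn_id_G := by
    rintro _ ⟨g, ⟨hg, hgD⟩, rfl⟩
    exact D.piecewise_eqOn_compl g id
  analytic_G := by
    rintro _ ⟨g, ⟨hg, hgD⟩, rfl⟩
    exact ((𝒰.analytic_G g hg).mono hDU).congr hDo (D.piecewise_eqOn g id).symm
  p := 𝒰.p
  continuousOn_p := 𝒰.continuousOn_p.mono hDU
  isOpen_image_p := 𝒰.isOpenMap_p D hDU hDo
  invariant_p := by
    rintro _ ⟨g, ⟨hg, hgD⟩, rfl⟩ x hx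
    simpa [hx] using 𝒰.invariant_p g hg x (hDU hx)
  exists_g_of_p_eq := by
    intro x hx y hy hxy
    obtain ⟨g, hg, rfl⟩ := 𝒰.exists_g_of_p_eq x (hDU hx) y (hDU hy) hxy
    exact ⟨_, ⟨g, ⟨hg, hD g hg x hx hy⟩, rfl⟩, by simp [hx]⟩
  isOpenMap_p := fun V hV hVo => 𝒰.isOpenMap_p V (hV.trans hDU) hVo

namespace IsUSEmbedding

variable {n : ℕ} {X : Type*} [TopologicalSpace X]

theorem of_subset {𝒰 𝒱 : UniformizingSystem n X} (h : 𝒰.Ut ⊆ 𝒱.Ut) (hp : 𝒱.p = 𝒰.p) :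
    IsUSEmbedding 𝒰 𝒱 id where
  mapsTo := h
  injOn := injOn_id _
  analyticOn := analyticOnNhd_id
  isOpen_image := by simpa using 𝒰.isOpen_Ut
  exists_analytic_inv := ⟨id, analyticOnNhd_id, fun _ _ => rfl⟩
  comp_p := fun x _ => congrFun hp x

theorem of_mem_G {𝒰 : UniformizingSystem n X} {g : CC n → CC n} (hg : g ∈ 𝒰.G) :
    IsUSEmbedding 𝒰 𝒰 g := by
  obtain ⟨g', hg', h1, h2⟩ := 𝒰.inv_mem_G g hg
  have himg : g '' 𝒰.Ut = 𝒰.Ut := (𝒰.mapsTo_G g hg).image_subset.antisymm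
    fun x hx => ⟨g' x, 𝒰.mapsTo_G g' hg' hx, h2 x⟩
  exact ⟨𝒰.mapsTo_G g hg, (Function.LeftInverse.injective h1).injOn, 𝒰.analytic_G g hg,
    himg.symm ▸ 𝒰.isOpen_Ut, ⟨g', himg.symm ▸ 𝒰.analytic_G g' hg', fun x _ => h1 x⟩,
    𝒰.invariant_p g hg⟩

theorem isOpen_image_of_subset {𝒰 𝒱 : UniformizingSystem n X} {l : CC n → CC n}
    (hl : IsUSEmbedding 𝒰 𝒱 l) {O : Set (CC n)} (hO : IsOpen O) (hOU : O ⊆ 𝒰.Ut) :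
    IsOpen (l '' O) := by
  obtain ⟨m, hm, hml⟩ := hl.exists_analytic_inv
  have : l '' O = l '' 𝒰.Ut ∩ m ⁻¹' O := by
    ext z
    constructor
    · rintro ⟨x, hx, rfl⟩
      exact ⟨⟨x, hOU hx, rfl⟩, by simpa [hml x (hOU hx)] using hx⟩
    · rintro ⟨⟨x, hx, rfl⟩, hz⟩
      exact ⟨x, by simpa [hml x hx] using hz, rfl⟩
  rw [this]
  exact hm.continuousOn.isOpen_inter_preimage hl.isOpen_image hO

theorem comp {𝒰 𝒱 𝒲 : UniformizingSystem n X} {l k : CC n → CC n}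
    (hk : IsUSEmbedding 𝒱 𝒲 k) (hl : IsUSEmbedding 𝒰 𝒱 l) : IsUSEmbedding 𝒰 𝒲 (k ∘ l) := by
  obtain ⟨m, hm, hml⟩ := hl.exists_analytic_inv
  obtain ⟨m', hm', hml'⟩ := hk.exists_analytic_inv
  refine ⟨hk.mapsTo.comp hl.mapsTo, hk.injOn.comp hl.injOn hl.mapsTo,
    hk.analyticOn.comp hl.analyticOn hl.mapsTo, ?_, ⟨m ∘ m', ?_, ?_⟩, ?_⟩
  · rw [image_comp]
    exact hk.isOpen_image_of_subset hl.isOpen_image hl.mapsTo.image_subset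
  · rw [image_comp]
    refine hm.comp (hm'.mono (image_mono hl.mapsTo.image_subset)) ?_
    rintro _ ⟨z, hz, rfl⟩
    rwa [hml' z (hl.mapsTo.image_subset hz)]
  · intro x hx
    simp [hml' _ (hl.mapsTo hx), hml x hx]
  · intro x hx
    simp [hk.comp_p _ (hl.mapsTo hx), hl.comp_p x hx]

/-- An embedding whose image lies in the image of another embedding factors through it. -/
theorem exists_factor {𝒰 𝒱 𝒲 : UniformizingSystem n X} {a b : CC n → CC n}
    (ha : IsUSEmbedding 𝒰 𝒲 a) (hb : IsUSEmbedding 𝒱 𝒲 b) (hba : MapsTo b 𝒱.Ut (a '' 𝒰.Ut)) :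
    ∃ l, IsUSEmbedding 𝒱 𝒰 l := by
  obtain ⟨m, hm, hma⟩ := ha.exists_analytic_inv
  obtain ⟨m', hm', hmb⟩ := hb.exists_analytic_inv
  have hspec : ∀ x ∈ 𝒱.Ut, m (b x) ∈ 𝒰.Ut ∧ a (m (b x)) = b x := by
    intro x hx
    obtain ⟨z, hz, hzx⟩ := hba hx
    rw [← hzx, hma z hz]
    exact ⟨hz, rfl⟩
  have himg : (m ∘ b) '' 𝒱.Ut = 𝒰.Ut ∩ a ⁻¹' (b '' 𝒱.Ut) := by
    ext z
    constructor
    · rintro ⟨x, hx, rfl⟩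
      exact ⟨(hspec x hx).1, x, hx, (hspec x hx).2.symm⟩
    · rintro ⟨hz, x, hx, hxz⟩
      exact ⟨x, hx, by simp [hxz, hma z hz]⟩
  refine ⟨m ∘ b, fun x hx => (hspec x hx).1, ?_, hm.comp hb.analyticOn hba, ?_,
    ⟨m' ∘ a, ?_, ?_⟩, ?_⟩
  · intro x hx x' hx' h
    apply hb.injOn hx hx'
    rw [← (hspec x hx).2, ← (hspec x' hx').2]
    exact congrArg a h
  · rw [himg]
    exact ha.analyticOn.continuousOn.isOpen_inter_preimage 𝒰.isOpen_Ut hb.isOpen_image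
  · rw [himg]
    exact hm'.comp (ha.analyticOn.mono inter_subset_left) fun z hz => hz.2
  · intro x hx
    simp [(hspec x hx).2, hmb x hx]
  · intro x hx
    rw [← hb.comp_p x hx, ← (hspec x hx).2, ha.comp_p _ (hspec x hx).1, Function.comp_apply]

open Topology in
/-- Given two embeddings into the same system, every sufficiently small open subsystem of the
second source embeds into the first source. -/
theorem exists_nhd_factor {𝒰 𝒱 𝒲 : UniformizingSystem n X} {a b : CC n → CC n}
    (ha : IsUSEmbedding 𝒰 𝒲 a) (hb : IsUSEmbedding 𝒱 𝒲 b) {y : CC n} (hy : y ∈ 𝒱.Ut)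
    (hyU : 𝒱.p y ∈ 𝒰.U) :
    ∃ N ∈ 𝓝 y, ∀ 𝒟 : UniformizingSystem n X, 𝒟.Ut ⊆ N → IsUSEmbedding 𝒟 𝒱 id →
      ∃ l, IsUSEmbedding 𝒟 𝒰 l := by
  obtain ⟨z, hz, hzy⟩ := hyU
  obtain ⟨g, hg, hgz⟩ := 𝒲.exists_g_of_p_eq (a z) (ha.mapsTo hz) (b y) (hb.mapsTo hy)
    (by rw [ha.comp_p z hz, hb.comp_p y hy, hzy])
  have hga := (of_mem_G hg).comp ha
  refine ⟨b ⁻¹' ((g ∘ a) '' 𝒰.Ut), ?_, fun 𝒟 hN h𝒟 => hga.exists_factor (hb.comp h𝒟) hN⟩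
  exact (hb.analyticOn y hy).continuousAt.preimage_mem_nhds
    (hga.isOpen_image.mem_nhds ⟨z, hz, hgz⟩)

end IsUSEmbedding

theorem AtlasEquiv.trans {n : ℕ} {X : Type*} [TopologicalSpace X] {𝒰 𝒱 𝒲 : OrbifoldAtlas n X}
    (h₁ : AtlasEquiv 𝒰 𝒱) (h₂ : AtlasEquiv 𝒱 𝒲) : AtlasEquiv 𝒰 𝒲 := by
  intro x
  obtain ⟨A, i, j, a, a', hxA, ha, ha'⟩ := h₁ x
  obtain ⟨B, j', k, b', b, hxB, hb', hb⟩ := h₂ x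
  have hU : ∀ {C E : UniformizingSystem n X} {l : CC n → CC n}, IsUSEmbedding C E l →
      x ∈ C.U → x ∈ E.U := by
    rintro C E l hl ⟨z, hz, hzx⟩
    exact ⟨l z, hl.mapsTo hz, (hl.comp_p z hz).trans hzx⟩
  obtain ⟨m, ⟨y, hy, rfl⟩, -, ⟨c, hc⟩, ⟨c', hc'⟩⟩ := 𝒱.compat j j' x ⟨hU ha' hxA, hU hb' hxB⟩
  obtain ⟨N, hN, hNA⟩ := ha'.exists_nhd_factor hc hy hxA
  obtain ⟨N', hN', hNB⟩ := hb'.exists_nhd_factor hc' hy hxB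
  obtain ⟨D, hDU, hDN, hyD, hDo, hDc, hD⟩ :=
    (𝒱.chart m).exists_invariant_nhd hy (Filter.inter_mem hN hN')
  set 𝒟 := (𝒱.chart m).restrict D hDU hDo hDc hD
  have hι : IsUSEmbedding 𝒟 (𝒱.chart m) id := .of_subset hDU rfl
  obtain ⟨l, hl⟩ := hNA 𝒟 (hDN.trans inter_subset_left) hι
  obtain ⟨l', hl'⟩ := hNB 𝒟 (hDN.trans inter_subset_right) hι
  exact ⟨𝒟, i, k, _, _, ⟨y, hyD, rfl⟩, ha.comp hl, hb.comp hl'⟩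

/-- Equivalence of orbifold atlases (of dimension `n` on a paracompact second countable
Hausdorff space `X`) is an equivalence relation. -/
theorem statement8 {n : ℕ} {X : Type*} [TopologicalSpace X] [T2Space X]
    [SecondCountableTopology X] [ParacompactSpace X] :
    Equivalence (AtlasEquiv (n := n) (X := X)) := by
  refine ⟨fun 𝒰 x => ?_, fun h x => ?_, AtlasEquiv.trans⟩
  · obtain ⟨i, hi⟩ := 𝒰.covers x
    exact ⟨𝒰.chart i, i, i, id, id, hi, .of_subset subset_rfl rfl, .of_subset subset_rfl rfl⟩
  · obtain ⟨W, i, j, l, l', hx, hl, hl'⟩ := h x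
    exact ⟨W, j, i, l', l, hx, hl', hl⟩
end
end
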